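/- Let h ≥ 1 and let G be a connected simple graph with vertex set V(G), equipped with the path metric d in which every edge has length 1. Suppose that to each pair of vertices x, y ∈ V(G) is associated a nonempty family P(x,y) of connected subgraphs of G, each containing both x and y, such that: (1) for all x, y, z ∈ V(G), every vertex of every subgraph in P(x,y) lies within distance h of some vertex of some subgraph in P(x,z) or in P(z,y); and (2) whenever d(x,y) ≤ 1, every subgraph in P(x,y) has vertex set contained in {x, y}. Then for any real m > 0 satisfying 2h(6 + log₂(m+2)) ≤ m and any δ ≥ (3m − 10h)/2, every geodesic triangle in G is δ-thin; in particular G is δ-thin hyperbolic. -/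

import Mathlib

/-- If `m` satisfies `2h(6 + log₂(m+2)) ≤ m`, then so does every larger number. -/
lemma two_mul_six_add_logb_le_of_le {h m m' : ℝ} (hh : 1 ≤ h) (hm : 0 < m)
    (hmh : 2 * h * (6 + Real.logb 2 (m + 2)) ≤ m) (hmm : m ≤ m') :
    2 * h * (6 + Real.logb 2 (m' + 2)) ≤ m' := by
  have hlog : Real.logb 2 (m' + 2) - Real.logb 2 (m + 2) ≤ 2 * ((m' - m) / (m + 2)) := by
    rw [← Real.logb_div (by linarith) (by linarith), Real.logb]
    have h₁ : Real.log ((m' + 2) / (m + 2)) ≤ (m' - m) / (m + 2) := by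
      refine (Real.log_le_sub_one_of_pos (by apply div_pos <;> linarith)).trans (le_of_eq ?_)
      field_simp
      ring
    have h₂ : 0 ≤ (m' - m) / (m + 2) := div_nonneg (by linarith) (by linarith)
    have h₃ := Real.log_two_gt_d9
    rw [div_le_iff₀ (by linarith)]
    nlinarith
  have hpos : 0 ≤ Real.logb 2 (m + 2) := Real.logb_nonneg (by norm_num) (by linarith)
  have h12 : 12 * h ≤ m := by nlinarith
  have hsmall : 2 * h * (2 * ((m' - m) / (m + 2))) ≤ m' - m := by
    have : 2 * h * (2 * ((m' - m) / (m + 2))) = (4 * h * (m' - m)) / (m + 2) := by ring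
    rw [this, div_le_iff₀ (by linarith)]
    nlinarith
  nlinarith

namespace SimpleGraph

variable {V : Type*} {G : SimpleGraph V} {h : ℝ} {L : V → V → Set V} {f : ℕ → V} {n : ℕ}

lemma Connected.cast_dist_triangle (hG : G.Connected) (u v w : V) :
    (G.dist u w : ℝ) ≤ G.dist u v + G.dist v w := by
  exact_mod_cast hG.dist_triangle

lemma Walk.dist_getVert_of_length_eq_dist (hG : G.Connected) {a b : V} {w : G.Walk a b}
    (hw : w.length = G.dist a b) {i j : ℕ} (hij : i ≤ j) (hj : j ≤ w.length) :
    G.dist (w.getVert i) (w.getVert j) = j - i := by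
  have h₁ : G.dist a (w.getVert i) ≤ i := by
    have := dist_le (w.take i)
    rw [w.take_length] at this
    omega
  have h₂ : G.dist (w.getVert j) b ≤ w.length - j := by
    have := dist_le (w.drop j)
    rwa [w.drop_length] at this
  have h₃ : G.dist (w.getVert i) (w.getVert j) ≤ j - i := by
    have := dist_le (((w.drop i).take (j - i)).copy rfl
      (by rw [w.drop_getVert, Nat.add_sub_cancel' hij]))
    rw [Walk.length_copy, Walk.take_length] at this
    omega
  have h₄ : G.dist a b ≤ G.dist a (w.getVert i) + G.dist (w.getVert i) b := hG.dist_triangle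
  have h₅ : G.dist (w.getVert i) b ≤
    G.dist (w.getVert i) (w.getVert j) + G.dist (w.getVert j) b := hG.dist_triangle
  omega

/-- Along a path of length at most `2 ^ k`, the set associated with the endpoints lies in the
`k * h`-neighborhood of the path. -/
lemma exists_dist_le_mul_of_le_two_pow (hG : G.Connected)
    (hL : ∀ x y z, ∀ v ∈ L x y, ∃ w ∈ L x z ∪ L z y, (G.dist v w : ℝ) ≤ h)
    (hL' : ∀ x y, G.dist x y ≤ 1 → L x y ⊆ {x, y})
    (hf : ∀ i, i + 1 ≤ n → G.dist (f i) (f (i + 1)) ≤ 1) (k : ℕ) :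
    ∀ i j, i ≤ j → j ≤ n → j - i ≤ 2 ^ k → ∀ p ∈ L (f i) (f j),
      ∃ a, i ≤ a ∧ a ≤ j ∧ (G.dist p (f a) : ℝ) ≤ k * h := by
  induction k with
  | zero =>
    intro i j hij hj hk p hp
    have hd : G.dist (f i) (f j) ≤ 1 := by
      obtain rfl | rfl : j = i ∨ j = i + 1 := by simp at hk; omega
      · simp
      · exact hf i hj
    rcases hL' _ _ hd hp with rfl | rfl
    · exact ⟨i, le_rfl, hij, by simp⟩
    · exact ⟨j, hij, le_rfl, by simp⟩
  | succ k ih =>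
    intro i j hij hj hk p hp
    rw [pow_succ] at hk
    obtain ⟨c, hic, hcj, hc₁, hc₂⟩ : ∃ c, i ≤ c ∧ c ≤ j ∧ c - i ≤ 2 ^ k ∧ j - c ≤ 2 ^ k := by
      refine ⟨min j (i + 2 ^ k), ?_, ?_, ?_, ?_⟩ <;> omega
    obtain ⟨w, hw, hpw⟩ := hL _ _ (f c) p hp
    have hwa : ∃ a, i ≤ a ∧ a ≤ j ∧ (G.dist w (f a) : ℝ) ≤ k * h := by
      rcases hw with hw | hw
      · obtain ⟨a, h₁, h₂, h₃⟩ := ih i c hic (hcj.trans hj) hc₁ w hw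
        exact ⟨a, h₁, h₂.trans hcj, h₃⟩
      · obtain ⟨a, h₁, h₂, h₃⟩ := ih c j hcj hj hc₂ w hw
        exact ⟨a, hic.trans h₁, h₂, h₃⟩
    obtain ⟨a, h₁, h₂, h₃⟩ := hwa
    refine ⟨a, h₁, h₂, ?_⟩
    have := hG.cast_dist_triangle p w (f a)
    push_cast
    linarith

/-- A set associated with the endpoints of a geodesic lies in a uniform neighborhood of it. -/
lemma exists_nat_dist_geodesic_le (hG : G.Connected) (hh : 1 ≤ h)
    (hL : ∀ x y z, ∀ v ∈ L x y, ∃ w ∈ L x z ∪ L z y, (G.dist v w : ℝ) ≤ h)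
    (hL' : ∀ x y, G.dist x y ≤ 1 → L x y ⊆ {x, y})
    (hf : ∀ i j, i ≤ j → j ≤ n → G.dist (f i) (f j) = j - i)
    {m : ℝ} (hm : 0 < m) (hmh : 2 * h * (6 + Real.logb 2 (m + 2)) ≤ m) :
    ∃ t : ℕ, (t : ℝ) ≤ m / 2 - 2 * h ∧ ∀ i j, i ≤ j → j ≤ n → ∀ p ∈ L (f i) (f j),
      ∃ a, i ≤ a ∧ a ≤ j ∧ G.dist p (f a) ≤ t := by
  classical
  have hpow := exists_dist_le_mul_of_le_two_pow (n := n) hG hL hL'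
    (fun i hi => by rw [hf i _ (by omega) hi]; omega)
  have hex : ∃ t : ℕ, ∀ i j, i ≤ j → j ≤ n → ∀ p ∈ L (f i) (f j),
      ∃ a, i ≤ a ∧ a ≤ j ∧ G.dist p (f a) ≤ t := by
    refine ⟨⌊(n : ℝ) * h⌋₊, fun i j hij hj p hp => ?_⟩
    obtain ⟨a, h₁, h₂, h₃⟩ := hpow n i j hij hj
      (by have := Nat.lt_two_pow_self (n := n); omega) p hp
    exact ⟨a, h₁, h₂, Nat.le_floor h₃⟩
  obtain ⟨t, ht, hmin⟩ := Nat.findX hex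
  refine ⟨t, ?_, ht⟩
  by_contra! hlt
  have hpos : 0 ≤ Real.logb 2 (m + 2) := Real.logb_nonneg (by norm_num) (by linarith)
  have h12 : 12 * h ≤ m := by nlinarith
  have ht0 : 0 < t := by
    have : (0 : ℝ) < t := by linarith
    exact_mod_cast this
  have hbad := hmin (t - 1) (by omega)
  push Not at hbad
  obtain ⟨i, j, hij, hj, p, hp, hfar⟩ := hbad
  obtain ⟨q, hiq, hqj, hq⟩ := ht i j hij hj p hp
  have hqR : (G.dist p (f q) : ℝ) ≤ t := by exact_mod_cast hq
  set s : ℕ := 2 * t + ⌊2 * h⌋₊ + 1 with hs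
  have hs_gt : 2 * t + 2 * h < (s : ℝ) := by
    have := Nat.lt_floor_add_one (2 * h)
    push_cast [hs]
    linarith
  have hs_le : (s : ℝ) ≤ 2 * t + 2 * h + 1 := by
    have := Nat.floor_le (show 0 ≤ 2 * h by linarith)
    push_cast [hs]
    linarith
  obtain ⟨i', hii', hi'q, hi's, hw⟩ : ∃ i', i ≤ i' ∧ i' ≤ q ∧ q ≤ i' + s ∧
      ∃ w ∈ L (f i') (f j), (G.dist p w : ℝ) ≤ h := by
    by_cases hqs : q ≤ i + s
    · exact ⟨i, le_rfl, hiq, hqs, p, hp, by simp; linarith⟩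
    refine ⟨q - s, by omega, by omega, by omega, ?_⟩
    obtain ⟨w, hw | hw, hpw⟩ := hL _ _ (f (q - s)) p hp
    · obtain ⟨a, ha₁, ha₂, ha₃⟩ := ht i (q - s) (by omega) (by omega) w hw
      have ha₃R : (G.dist w (f a) : ℝ) ≤ t := by exact_mod_cast ha₃
      have hd := hf a q (by omega) (by omega)
      have hd' : (s : ℝ) ≤ G.dist (f a) (f q) := by
        rw [hd]; exact_mod_cast (by omega : s ≤ q - a)
      rw [dist_comm] at hd'
      have e₁ := hG.cast_dist_triangle (f q) p (f a)
      have e₂ := hG.cast_dist_triangle p w (f a)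
      rw [G.dist_comm (u := f q) (v := p)] at e₁
      linarith
    · exact ⟨w, hw, hpw⟩
  obtain ⟨w, hw, hpw⟩ := hw
  obtain ⟨j', hj'j, hqj', hj's, w', hw', hpw'⟩ : ∃ j', j' ≤ j ∧ q ≤ j' ∧ j' ≤ q + s ∧
      ∃ w' ∈ L (f i') (f j'), (G.dist p w' : ℝ) ≤ 2 * h := by
    by_cases hqs : j ≤ q + s
    · exact ⟨j, le_rfl, hqj, hqs, w, hw, by linarith⟩
    refine ⟨q + s, by omega, by omega, le_rfl, ?_⟩
    obtain ⟨w', hw' | hw', hww'⟩ := hL _ _ (f (q + s)) w hw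
    · exact ⟨w', hw', by have := hG.cast_dist_triangle p w w'; linarith⟩
    · obtain ⟨a, ha₁, ha₂, ha₃⟩ := ht (q + s) j (by omega) hj w' hw'
      have ha₃R : (G.dist w' (f a) : ℝ) ≤ t := by exact_mod_cast ha₃
      have hd := hf q a (by omega) (by omega)
      have hd' : (s : ℝ) ≤ G.dist (f q) (f a) := by
        rw [hd]; exact_mod_cast (by omega : s ≤ a - q)
      have e₁ := hG.cast_dist_triangle (f q) p (f a)
      have e₂ := hG.cast_dist_triangle p w (f a)
      have e₃ := hG.cast_dist_triangle w w' (f a)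
      rw [G.dist_comm (u := f q) (v := p)] at e₁
      linarith
  have hclog := Nat.le_pow_clog (b := 2) (by norm_num) (2 * s)
  have hk_lt := Nat.pow_pred_clog_lt_self (b := 2) (by norm_num) (x := 2 * s) (by omega)
  have hk_pos := Nat.clog_pos (b := 2) (by norm_num) (n := 2 * s) (by omega)
  set k := Nat.clog 2 (2 * s)
  obtain ⟨a, ha₁, ha₂, ha₃⟩ := hpow k i' j' (by omega) (by omega) (by omega) w' hw'
  have hta : (t : ℝ) ≤ G.dist p (f a) := by
    have := hfar a (by omega) (by omega)
    exact_mod_cast (by omega : t ≤ G.dist p (f a))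
  have htri := hG.cast_dist_triangle p w' (f a)
  have hs_pos : (0 : ℝ) < s := by linarith [Nat.cast_nonneg (α := ℝ) t]
  have hk : (k : ℝ) < 2 + Real.logb 2 s := by
    have h₁ : ((2 : ℝ) ^ (k - 1 : ℕ)) < 2 * s := by exact_mod_cast hk_lt
    have h₂ := Real.logb_lt_logb (b := 2) (by norm_num) (by positivity) h₁
    rw [Real.logb_pow, Real.logb_mul (by norm_num) hs_pos.ne',
      Real.logb_self_eq_one (by norm_num), Nat.cast_sub hk_pos] at h₂
    push_cast at h₂
    linarith
  have hlog : Real.logb 2 s ≤ Real.logb 2 (2 * t + 4 * h + 2) :=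
    Real.logb_le_logb_of_le (by norm_num) hs_pos (by linarith)
  have hmono := two_mul_six_add_logb_le_of_le (m' := 2 * t + 4 * h) hh hm hmh (by linarith)
  nlinarith

/-- A geodesic lies in a neighborhood of a connected subgraph joining its endpoints that is
contained in a neighborhood of the geodesic. -/
lemma exists_dist_geodesic_vertex_le (hG : G.Connected) {H : G.Subgraph} (hH : H.Connected)
    (hf : ∀ i j, i ≤ j → j ≤ n → G.dist (f i) (f j) = j - i)
    (h0 : f 0 ∈ H.verts) (hn : f n ∈ H.verts) {t : ℕ}
    (ht : ∀ p ∈ H.verts, ∃ a, a ≤ n ∧ G.dist p (f a) ≤ t) {r : ℕ} (hr : r ≤ n) :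
    ∃ u ∈ H.verts, G.dist (f r) u ≤ 2 * t := by
  obtain ⟨u, hu, u', hu', huu', ⟨a, ha, hau⟩, b, hb, hbn, hbu⟩ :
      ∃ u ∈ H.verts, ∃ u' ∈ H.verts, G.dist u u' ≤ 1 ∧ (∃ a ≤ r, G.dist u (f a) ≤ t) ∧
        ∃ b, r ≤ b ∧ b ≤ n ∧ G.dist u' (f b) ≤ t := by
    by_cases hnA : ∃ a ≤ r, G.dist (f n) (f a) ≤ t
    · exact ⟨f n, hn, f n, hn, by simp, hnA, n, hr, le_rfl, by simp⟩
    obtain ⟨w⟩ := hH.coe.preconnected ⟨f 0, h0⟩ ⟨f n, hn⟩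
    obtain ⟨d, -, hd₁, hd₂⟩ := w.exists_boundary_dart {u | ∃ a ≤ r, G.dist u.1 (f a) ≤ t}
      ⟨0, Nat.zero_le _, by simp⟩ hnA
    refine ⟨d.fst, d.fst.2, d.snd, d.snd.2, ?_, hd₁, ?_⟩
    · exact (dist_eq_one_iff_adj.2 (H.adj_sub d.adj)).le
    · obtain ⟨b, hb, hbd⟩ := ht d.snd d.snd.2
      refine ⟨b, ?_, hb, hbd⟩
      by_contra! hbr
      exact hd₂ ⟨b, hbr.le, hbd⟩
  have e₁ := hf a r ha hr
  have e₂ := hf r b hb hbn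
  have e₃ := hf a b (ha.trans hb) hbn
  have t₁ : G.dist (f a) (f b) ≤ G.dist (f a) u + G.dist u (f b) := hG.dist_triangle
  have t₂ : G.dist u (f b) ≤ G.dist u u' + G.dist u' (f b) := hG.dist_triangle
  have t₃ : G.dist (f r) u ≤ G.dist (f r) (f a) + G.dist (f a) u := hG.dist_triangle
  have t₄ : G.dist (f r) u' ≤ G.dist (f r) (f b) + G.dist (f b) u' := hG.dist_triangle
  rw [G.dist_comm (u := f a) (v := u)] at t₁ t₃
  rw [G.dist_comm (u := f b) (v := u')] at t₄
  rw [G.dist_comm (u := f r) (v := f a)] at t₃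
  by_cases hra : r - a ≤ t
  · exact ⟨u, hu, by omega⟩
  · exact ⟨u', hu', by omega⟩

end SimpleGraph


/-- Bowditch's criterion for families of paths: Let `h ≥ 1` and
let `G` be a connected simple graph. Suppose each pair of vertices `x, y` is
assigned a nonempty family `P x y` of connected subgraphs of `G`, each
containing `x` and `y`, such that (1) every vertex of every member of `P x y`
lies within distance `h` of a vertex of some member of `P x z` or of `P z y`,
and (2) whenever `d(x,y) ≤ 1`, every member of `P x y` has vertex set contained
in `{x, y}`. Then for any `m > 0` with `2h(6 + log₂(m+2)) ≤ m` and any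
`δ ≥ (3m - 10h)/2`, every geodesic triangle in `G` is `δ`-thin. -/
theorem bowditch_criterion_families {V : Type*} (G : SimpleGraph V)
    (hG : G.Connected) (h : ℝ) (hh : 1 ≤ h)
    (P : V → V → Set G.Subgraph)
    (hPne : ∀ x y : V, (P x y).Nonempty)
    (hPconn : ∀ x y : V, ∀ H ∈ P x y, H.Connected)
    (hPx : ∀ x y : V, ∀ H ∈ P x y, x ∈ H.verts)
    (hPy : ∀ x y : V, ∀ H ∈ P x y, y ∈ H.verts)
    (h1 : ∀ x y z : V, ∀ H ∈ P x y, ∀ v ∈ H.verts,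
      ∃ H', (H' ∈ P x z ∨ H' ∈ P z y) ∧
        ∃ w ∈ H'.verts, (G.dist v w : ℝ) ≤ h)
    (h2 : ∀ x y : V, G.dist x y ≤ 1 →
      ∀ H ∈ P x y, H.verts ⊆ {x, y}) :
    ∀ m : ℝ, 0 < m → 2 * h * (6 + Real.logb 2 (m + 2)) ≤ m →
    ∀ δ : ℝ, (3 * m - 10 * h) / 2 ≤ δ →
    ∀ (a b c : V) (w₁ : G.Walk a b) (w₂ : G.Walk b c) (w₃ : G.Walk c a),
      w₁.length = G.dist a b → w₂.length = G.dist b c → w₃.length = G.dist c a →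
      (∀ p ∈ w₁.support, ∃ q, (q ∈ w₂.support ∨ q ∈ w₃.support) ∧
        (G.dist p q : ℝ) ≤ δ) ∧
      (∀ p ∈ w₂.support, ∃ q, (q ∈ w₃.support ∨ q ∈ w₁.support) ∧
        (G.dist p q : ℝ) ≤ δ) ∧
      (∀ p ∈ w₃.support, ∃ q, (q ∈ w₁.support ∨ q ∈ w₂.support) ∧
        (G.dist p q : ℝ) ≤ δ) := by
  intro m hm hmh δ hδ
  set L : V → V → Set V := fun x y => {v | ∃ H ∈ P x y, v ∈ H.verts}
  have hL : ∀ x y z, ∀ v ∈ L x y, ∃ w ∈ L x z ∪ L z y, (G.dist v w : ℝ) ≤ h := by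
    rintro x y z v ⟨H, hH, hv⟩
    obtain ⟨H', hH' | hH', w, hw, hd⟩ := h1 x y z H hH v hv
    · exact ⟨w, Or.inl ⟨H', hH', hw⟩, hd⟩
    · exact ⟨w, Or.inr ⟨H', hH', hw⟩, hd⟩
  have hL' : ∀ x y, G.dist x y ≤ 1 → L x y ⊆ {x, y} := by
    rintro x y hxy v ⟨H, hH, hv⟩
    exact h2 x y hxy H hH hv
  have hnear : ∀ {x y : V} (w : G.Walk x y), w.length = G.dist x y →
      ∃ t : ℕ, (t : ℝ) ≤ m / 2 - 2 * h ∧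
        ∀ p ∈ L x y, ∃ a ≤ w.length, G.dist p (w.getVert a) ≤ t := by
    intro x y w hw
    obtain ⟨t, htm, ht⟩ := SimpleGraph.exists_nat_dist_geodesic_le (n := w.length) hG hh hL hL'
      (fun i j hij hj => w.dist_getVert_of_length_eq_dist hG hw hij hj) hm hmh
    refine ⟨t, htm, fun p hp => ?_⟩
    obtain ⟨a, -, ha, hpa⟩ := ht 0 w.length (Nat.zero_le _) le_rfl p (by simpa using hp)
    exact ⟨a, ha, hpa⟩
  have hside : ∀ {x y z : V} (w : G.Walk x y) (u : G.Walk x z) (v : G.Walk z y),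
      w.length = G.dist x y → u.length = G.dist x z → v.length = G.dist z y →
      ∀ p ∈ w.support, ∃ q, (q ∈ u.support ∨ q ∈ v.support) ∧ (G.dist p q : ℝ) ≤ δ := by
    intro x y z w u v hw hu hv p hp
    obtain ⟨r, rfl, hr⟩ := SimpleGraph.Walk.mem_support_iff_exists_getVert.1 hp
    obtain ⟨H, hH⟩ := hPne x y
    obtain ⟨t, htm, ht⟩ := hnear w hw
    obtain ⟨p₁, hp₁, hd₁⟩ := SimpleGraph.exists_dist_geodesic_vertex_le (f := w.getVert)
      hG (hPconn x y H hH) (fun i j hij hj => w.dist_getVert_of_length_eq_dist hG hw hij hj)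
      (by simpa using hPx x y H hH) (by simpa using hPy x y H hH)
      (fun p hp => ht p ⟨H, hH, hp⟩) hr
    have hd₁R : (G.dist (w.getVert r) p₁ : ℝ) ≤ 2 * t := by exact_mod_cast hd₁
    obtain ⟨p₂, hp₂, hd₂⟩ := hL x y z p₁ ⟨H, hH, hp₁⟩
    have hq : ∃ q, (q ∈ u.support ∨ q ∈ v.support) ∧ (G.dist p₂ q : ℝ) ≤ m / 2 - 2 * h := by
      rcases hp₂ with hp₂ | hp₂
      · obtain ⟨t', htm', ht'⟩ := hnear u hu
        obtain ⟨a, -, ha⟩ := ht' p₂ hp₂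
        exact ⟨_, Or.inl (u.getVert_mem_support a), le_trans (by exact_mod_cast ha) htm'⟩
      · obtain ⟨t', htm', ht'⟩ := hnear v hv
        obtain ⟨a, -, ha⟩ := ht' p₂ hp₂
        exact ⟨_, Or.inr (v.getVert_mem_support a), le_trans (by exact_mod_cast ha) htm'⟩
    obtain ⟨q, hq, hd₃⟩ := hq
    refine ⟨q, hq, ?_⟩
    have e₁ := hG.cast_dist_triangle (w.getVert r) p₁ q
    have e₂ := hG.cast_dist_triangle p₁ p₂ q
    linarith
  have hrev : ∀ {x y : V} (w : G.Walk x y), w.length = G.dist x y →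
      w.reverse.length = G.dist y x := by
    intro x y w hw
    rw [w.length_reverse, hw, G.dist_comm]
  intro a b c w₁ w₂ w₃ hw₁ hw₂ hw₃
  refine ⟨fun p hp => ?_, fun p hp => ?_, fun p hp => ?_⟩
  · simpa [or_comm] using
      hside w₁ w₃.reverse w₂.reverse hw₁ (hrev w₃ hw₃) (hrev w₂ hw₂) p hp
  · simpa [or_comm] using
      hside w₂ w₁.reverse w₃.reverse hw₂ (hrev w₁ hw₁) (hrev w₃ hw₃) p hp
  · simpa [or_comm] using
      hside w₃ w₂.reverse w₁.reverse hw₃ (hrev w₂ hw₂) (hrev w₁ hw₁) p hp
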